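/- arXiv:0809.3286 — 2 statements merged into one kernel-verified Lean document; each statement's English description precedes it below -/
import Mathlib

section
/- Let X be a uniformly discrete, bounded geometry, quasi-geodesic metric space and f a control function. Then there exists an f-controlled 1-chain ψ on X with ∂ψ(x) = 1 for all x ∈ X if and only if there exists an f-controlled 1-chain ψ' with propagation at most 1 (i.e. ψ'(x,y) = 0 whenever d(x,y) > 1) and ∂ψ'(x) = 1 for all x ∈ X. -/
/-- A metric space is uniformly discrete if distinct points are uniformly separated. -/
def UnifDiscrete (X : Type*) [MetricSpace X] : Prop :=
  ∃ c > (0:ℝ), ∀ x y : X, x ≠ y → c ≤ dist x y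

/-- A metric space has bounded geometry if balls of each radius have uniformly
bounded (finite) cardinality. -/
def BddGeom (X : Type*) [MetricSpace X] : Prop :=
  ∀ r > (0:ℝ), ∃ N : ℕ, ∀ x : X,
    (Metric.closedBall x r).Finite ∧ (Metric.closedBall x r).ncard ≤ N

/-- Quasi-geodesic: any two points are joined by a chain of `≤ d(x,y)` unit steps. -/
def QuasiGeodesic (X : Type*) [MetricSpace X] : Prop :=
  ∀ x y : X, ∃ n : ℕ, ∃ p : ℕ → X,
    p 0 = x ∧ p n = y ∧ (∀ i < n, dist (p i) (p (i + 1)) ≤ 1) ∧ (n : ℝ) ≤ dist x y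

/-- A control function: non-decreasing, nonnegative on `[0,∞)`, `f 0 = 1`, with
controlled behaviour under additive shifts and multiplicative rescalings. -/
structure IsControlFun (f : ℝ → ℝ) : Prop where
  nonneg : ∀ t : ℝ, 0 ≤ t → 0 ≤ f t
  mono : ∀ s t : ℝ, 0 ≤ s → s ≤ t → f s ≤ f t
  one_at_zero : f 0 = 1
  shift : ∀ K > (0:ℝ), ∃ L > (0:ℝ), ∀ t > (0:ℝ), f (t + K) ≤ L * f t
  scale : ∀ K > (0:ℝ), ∃ L > (0:ℝ), ∀ t > (0:ℝ), f (K * t) ≤ L * f t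

/-- An `f`-controlled 1-chain on `X` with basepoint `e`: antisymmetric, of finite
propagation, with coefficients bounded by a multiple of `f (max |x| |y|)`. -/
structure IsCtrlChain {X : Type*} [MetricSpace X] (e : X) (f : ℝ → ℝ) (ψ : X → X → ℝ) : Prop where
  antisymm : ∀ x y, ψ x y = - ψ y x
  finprop : ∃ R > (0:ℝ), ∀ x y, R < dist x y → ψ x y = 0
  bound : ∃ K > (0:ℝ), ∀ x y, |ψ x y| ≤ K * f (max (dist x e) (dist y e))

open scoped Classical in
/-- The signed number of times the path `p 0, …, p n` crosses the edge from `a` to `b`. -/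
noncomputable def edgeFlow {X : Type*} (p : ℕ → X) (n : ℕ) (a b : X) : ℝ :=
  ∑ i ∈ Finset.range n,
    ((if p i = a ∧ p (i + 1) = b then 1 else 0) - (if p i = b ∧ p (i + 1) = a then 1 else 0))

theorem edgeFlow_antisymm {X : Type*} (p : ℕ → X) (n : ℕ) (a b : X) :
    edgeFlow p n a b = -edgeFlow p n b a := by
  simp [edgeFlow]

theorem abs_edgeFlow_le {X : Type*} (p : ℕ → X) (n : ℕ) (a b : X) :
    |edgeFlow p n a b| ≤ n := by
  unfold edgeFlow
  refine (Finset.abs_sum_le_sum_abs _ _).trans ?_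
  refine (Finset.sum_le_card_nsmul _ _ 1 fun i _ => ?_).trans (by simp)
  split_ifs <;> norm_num

theorem exists_edge_of_edgeFlow_ne_zero {X : Type*} {p : ℕ → X} {n : ℕ} {a b : X}
    (h : edgeFlow p n a b ≠ 0) :
    ∃ i < n, (p i = a ∧ p (i + 1) = b) ∨ (p i = b ∧ p (i + 1) = a) := by
  obtain ⟨i, hi, hne⟩ := Finset.exists_ne_zero_of_sum_ne_zero h
  refine ⟨i, Finset.mem_range.1 hi, ?_⟩
  by_contra! hcon
  apply hne
  rw [if_neg (fun hh => hcon.1 hh.1 hh.2), if_neg (fun hh => hcon.2 hh.1 hh.2), sub_zero]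

open scoped Classical in
/-- The boundary of the flow along a path is its end point minus its starting point. -/
theorem sum_edgeFlow {X : Type*} [MetricSpace X] {p : ℕ → X} {n : ℕ}
    (hp : ∀ i < n, dist (p i) (p (i + 1)) ≤ 1) (b : X) {T : Finset X}
    (hT : ∀ a, dist a b ≤ 1 → a ∈ T) :
    ∑ a ∈ T, edgeFlow p n a b = (if p n = b then 1 else 0) - (if p 0 = b then 1 else 0) := by
  unfold edgeFlow
  rw [Finset.sum_comm, ← Finset.sum_range_sub (fun i => if p i = b then (1 : ℝ) else 0)]
  refine Finset.sum_congr rfl fun i hi => ?_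
  have hi' := hp i (Finset.mem_range.1 hi)
  rw [Finset.sum_sub_distrib]
  congr 1
  · by_cases h : p (i + 1) = b
    · have : p i ∈ T := hT _ (h ▸ hi')
      simp [h, this]
    · simp [h]
  · by_cases h : p i = b
    · have : p (i + 1) ∈ T := hT _ (by rw [dist_comm]; exact h ▸ hi')
      simp [h, this]
    · simp [h]

theorem dist_le_of_unit_steps {X : Type*} [MetricSpace X] {p : ℕ → X} {n : ℕ}
    (hp : ∀ i < n, dist (p i) (p (i + 1)) ≤ 1) {j : ℕ} (hj : j ≤ n) :
    dist (p 0) (p j) ≤ n ∧ dist (p n) (p j) ≤ n := by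
  constructor
  · refine (dist_le_Ico_sum_of_dist_le (f := p) (d := fun _ => 1) (Nat.zero_le j)
      fun _ hk => hp _ (hk.trans_le hj)).trans ?_
    simpa using hj
  · rw [dist_comm]
    refine (dist_le_Ico_sum_of_dist_le (f := p) (d := fun _ => 1) hj fun _ hk => hp _ hk).trans ?_
    simp

theorem IsControlFun.exists_shift_le {f : ℝ → ℝ} (hf : IsControlFun f) {K : ℝ} (hK : 0 < K) :
    ∃ L > (0 : ℝ), ∀ t, 0 ≤ t → f (t + K) ≤ L * f t := by
  obtain ⟨L, hL, h⟩ := hf.shift K hK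
  refine ⟨max L (f K), lt_max_of_lt_left hL, fun t ht => ?_⟩
  rcases ht.eq_or_lt with rfl | ht
  · simp [hf.one_at_zero]
  · exact (h t ht).trans (mul_le_mul_of_nonneg_right (le_max_left _ _) (hf.nonneg t ht.le))

/-- The chain obtained from `ψ` by replacing each edge `(x, y)` with the path `p x y`
of length `n x y`; the factor `1 / 2` accounts for each edge occurring in both directions. -/
noncomputable def subdivide {X : Type*} (n : X → X → ℕ) (p : X → X → ℕ → X) (ψ : X → X → ℝ)
    (a b : X) : ℝ :=
  1 / 2 * ∑ᶠ q : X × X, ψ q.1 q.2 * edgeFlow (p q.1 q.2) (n q.1 q.2) a b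

theorem subdivide_antisymm {X : Type*} (n : X → X → ℕ) (p : X → X → ℕ → X) (ψ : X → X → ℝ)
    (a b : X) : subdivide n p ψ a b = -subdivide n p ψ b a := by
  unfold subdivide
  rw [← mul_neg, ← finsum_neg_distrib]
  congr 2
  ext q
  rw [edgeFlow_antisymm, mul_neg]

section Subdivide

variable {X : Type*} [MetricSpace X] {n : X → X → ℕ} {p : X → X → ℕ → X} {ψ : X → X → ℝ} {R : ℝ}

theorem subdivide_eq_sum (h0 : ∀ x y, p x y 0 = x) (hn : ∀ x y, p x y (n x y) = y)
    (hp : ∀ x y, ∀ i < n x y, dist (p x y i) (p x y (i + 1)) ≤ 1)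
    (hlen : ∀ x y, (n x y : ℝ) ≤ dist x y) (hR : ∀ x y, R < dist x y → ψ x y = 0)
    {b : X} {S : Finset X} (hS : ∀ x, dist x b ≤ R → x ∈ S) (a : X) :
    subdivide n p ψ a b =
      1 / 2 * ∑ q ∈ S ×ˢ S, ψ q.1 q.2 * edgeFlow (p q.1 q.2) (n q.1 q.2) a b := by
  unfold subdivide
  rw [finsum_eq_sum_of_support_subset]
  rintro ⟨x, y⟩ hq
  have hψ : dist x y ≤ R := by
    by_contra! h
    exact left_ne_zero_of_mul hq (hR x y h)
  obtain ⟨i, hi, hab⟩ := exists_edge_of_edgeFlow_ne_zero (right_ne_zero_of_mul hq)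
  obtain ⟨j, hj, rfl⟩ : ∃ j ≤ n x y, p x y j = b := by
    rcases hab with h | h
    exacts [⟨i + 1, hi, h.2⟩, ⟨i, hi.le, h.1⟩]
  have hd := dist_le_of_unit_steps (hp x y) hj
  rw [h0, hn] at hd
  have hle := (hlen x y).trans hψ
  simpa using ⟨hS _ (hd.1.trans hle), hS _ (hd.2.trans hle)⟩

theorem subdivide_eq_zero (hp : ∀ x y, ∀ i < n x y, dist (p x y i) (p x y (i + 1)) ≤ 1)
    {a b : X} (hab : 1 < dist a b) : subdivide n p ψ a b = 0 := by
  unfold subdivide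
  rw [finsum_eq_zero_of_forall_eq_zero, mul_zero]
  rintro ⟨x, y⟩
  refine mul_eq_zero_of_right _ ?_
  by_contra h
  obtain ⟨i, hi, ⟨rfl, rfl⟩ | ⟨rfl, rfl⟩⟩ := exists_edge_of_edgeFlow_ne_zero h
  · exact hab.not_ge (hp x y i hi)
  · exact hab.not_ge (dist_comm (p x y i) _ ▸ hp x y i hi)

theorem finsum_subdivide (hfin : ∀ (x : X) (r : ℝ), (Metric.closedBall x r).Finite)
    (h0 : ∀ x y, p x y 0 = x) (hn : ∀ x y, p x y (n x y) = y)
    (hp : ∀ x y, ∀ i < n x y, dist (p x y i) (p x y (i + 1)) ≤ 1)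
    (hlen : ∀ x y, (n x y : ℝ) ≤ dist x y) (hanti : ∀ x y, ψ x y = -ψ y x)
    (hR0 : 0 ≤ R) (hR : ∀ x y, R < dist x y → ψ x y = 0) (b : X) :
    ∑ᶠ a, subdivide n p ψ a b = ∑ᶠ a, ψ a b := by
  classical
  set S := (hfin b R).toFinset with hSdef
  set T := (hfin b 1).toFinset with hTdef
  have hS : ∀ x, dist x b ≤ R → x ∈ S := by simp [hSdef]
  have hT : ∀ x, dist x b ≤ 1 → x ∈ T := by simp [hTdef]
  have hbS : b ∈ S := hS b (by simpa using hR0)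
  rw [finsum_eq_sum_of_support_subset (s := T), finsum_eq_sum_of_support_subset (s := S)]
  · simp_rw [subdivide_eq_sum h0 hn hp hlen hR hS]
    rw [← Finset.mul_sum, Finset.sum_comm]
    simp_rw [← Finset.mul_sum, sum_edgeFlow (hp _ _) b hT, h0, hn]
    rw [Finset.sum_product]
    simp only [mul_sub, Finset.sum_sub_distrib, mul_ite, mul_one, mul_zero,
      Finset.sum_ite_eq', hbS, if_true]
    rw [Finset.sum_comm (f := fun x y => if x = b then ψ x y else 0)]
    simp only [Finset.sum_ite_eq', hbS, if_true]
    simp_rw [hanti b, Finset.sum_neg_distrib]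
    ring
  · intro x hx
    refine hS x ?_
    by_contra! h
    exact hx (hR x b h)
  · intro x hx
    refine hT x ?_
    by_contra! h
    exact hx (subdivide_eq_zero hp h)

theorem exists_abs_subdivide_le {e : X} {f : ℝ → ℝ} (hbg : BddGeom X) (hf : IsControlFun f)
    (h0 : ∀ x y, p x y 0 = x) (hn : ∀ x y, p x y (n x y) = y)
    (hp : ∀ x y, ∀ i < n x y, dist (p x y i) (p x y (i + 1)) ≤ 1)
    (hlen : ∀ x y, (n x y : ℝ) ≤ dist x y)
    (hR0 : 0 < R) (hR : ∀ x y, R < dist x y → ψ x y = 0)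
    (hbound : ∃ K > (0 : ℝ), ∀ x y, |ψ x y| ≤ K * f (max (dist x e) (dist y e))) :
    ∃ K > (0 : ℝ), ∀ a b, |subdivide n p ψ a b| ≤ K * f (max (dist a e) (dist b e)) := by
  obtain ⟨K, hK, hψ⟩ := hbound
  obtain ⟨N, hN⟩ := hbg R hR0
  obtain ⟨L, hL, hshift⟩ := hf.exists_shift_le hR0
  refine ⟨((N : ℝ) * N + 1) * (K * L * R), by positivity, fun a b => ?_⟩
  set S := (hN b).1.toFinset with hSdef
  have hmem : ∀ x, x ∈ S ↔ dist x b ≤ R := by simp [hSdef]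
  have hcard : S.card ≤ N := by
    rw [hSdef, ← Set.ncard_eq_toFinset_card _ (hN b).1]
    exact (hN b).2
  set M := f (max (dist a e) (dist b e)) with hM
  have hM0 : 0 ≤ M := hf.nonneg _ (le_max_of_le_left dist_nonneg)
  have hterm : ∀ q ∈ S ×ˢ S,
      |ψ q.1 q.2 * edgeFlow (p q.1 q.2) (n q.1 q.2) a b| ≤ K * L * R * M := by
    rintro ⟨x, y⟩ hq
    obtain ⟨hx, hy⟩ := Finset.mem_product.1 hq
    rw [hmem] at hx hy
    dsimp only at hx hy ⊢
    rcases lt_or_ge R (dist x y) with h | h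
    · rw [hR x y h, zero_mul, abs_zero]
      positivity
    have hf1 : f (max (dist x e) (dist y e)) ≤ L * M := by
      refine (hf.mono _ (dist b e + R) (le_max_of_le_left dist_nonneg) (max_le ?_ ?_)).trans
        ((hshift _ dist_nonneg).trans
          (mul_le_mul_of_nonneg_left (hf.mono _ _ dist_nonneg (le_max_right _ _)) hL.le))
      · linarith [dist_triangle x b e]
      · linarith [dist_triangle y b e]
    rw [abs_mul]
    calc |ψ x y| * |edgeFlow (p x y) (n x y) a b| ≤ (K * (L * M)) * R :=
          mul_le_mul ((hψ x y).trans (mul_le_mul_of_nonneg_left hf1 hK.le))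
            ((abs_edgeFlow_le _ _ _ _).trans ((hlen x y).trans h)) (abs_nonneg _) (by positivity)
      _ = K * L * R * M := by ring
  rw [subdivide_eq_sum h0 hn hp hlen hR (fun x => (hmem x).2), abs_mul]
  have hsum : |∑ q ∈ S ×ˢ S, ψ q.1 q.2 * edgeFlow (p q.1 q.2) (n q.1 q.2) a b| ≤
      (N : ℝ) * N * (K * L * R * M) := by
    refine (Finset.abs_sum_le_sum_abs _ _).trans ((Finset.sum_le_card_nsmul _ _ _ hterm).trans ?_)
    rw [nsmul_eq_mul, Finset.card_product]
    push_cast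
    gcongr
  have hC : 0 ≤ K * L * R * M := by positivity
  have habs : |(1 / 2 : ℝ)| ≤ 1 := by norm_num [abs_le]
  refine (mul_le_of_le_one_left (abs_nonneg _) habs).trans (hsum.trans ?_)
  linarith

end Subdivide

/-- The fundamental class bounds an `f`-controlled 1-chain iff it
bounds one of propagation at most `1`. -/
theorem fundamental_class_vanishes_iff_propagation_one
    {X : Type*} [MetricSpace X] (e : X) (f : ℝ → ℝ)
    (hud : UnifDiscrete X) (hbg : BddGeom X) (hqg : QuasiGeodesic X)
    (hf : IsControlFun f) :
    (∃ ψ : X → X → ℝ, IsCtrlChain e f ψ ∧ ∀ x : X, ∑ᶠ y : X, ψ y x = 1) ↔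
      (∃ ψ : X → X → ℝ, IsCtrlChain e f ψ ∧ (∀ x y : X, 1 < dist x y → ψ x y = 0) ∧
        ∀ x : X, ∑ᶠ y : X, ψ y x = 1) := by
  constructor
  · rintro ⟨ψ, ⟨hanti, ⟨R, hR0, hR⟩, hbound⟩, hψ⟩
    choose n p h0 hn hp hlen using hqg
    have hfin (x : X) (r : ℝ) : (Metric.closedBall x r).Finite := by
      obtain ⟨_, h⟩ := hbg (max r 1) (by positivity)
      exact (h x).1.subset (Metric.closedBall_subset_closedBall (le_max_left _ _))
    refine ⟨subdivide n p ψ, ⟨subdivide_antisymm n p ψ, ⟨1, one_pos, fun _ _ => subdivide_eq_zero hp⟩,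
      exists_abs_subdivide_le hbg hf h0 hn hp hlen hR0 hR hbound⟩,
      fun _ _ => subdivide_eq_zero hp, fun x => ?_⟩
    rw [finsum_subdivide hfin h0 hn hp hlen hanti hR0.le hR, hψ]
  · rintro ⟨ψ, hc, -, hψ⟩
    exact ⟨ψ, hc, hψ⟩
end

section
/- Let X and Y be uniformly discrete metric spaces of bounded geometry and f a control function. If F : X → Y is a quasi-isometry, then for every n ≥ 0 the pushforward F_* induces an isomorphism of real vector spaces H_n^f(X) ≅ H_n^f(Y). In particular, H_n^f is a quasi-isometry invariant. -/
/-- An `f`-controlled `n`-chain on `X`: an alternating function on `(n+1)`-tuples,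
of finite propagation, with coefficients controlled by `f`. -/
def IsNChain {X : Type*} [MetricSpace X] (e : X) (f : ℝ → ℝ) (n : ℕ)
    (ψ : (Fin (n + 1) → X) → ℝ) : Prop :=
  (∀ σ : Equiv.Perm (Fin (n + 1)), ∀ x : Fin (n + 1) → X,
      ψ (x ∘ σ) = ((Equiv.Perm.sign σ : ℤ) : ℝ) * ψ x) ∧
  (∃ R > (0:ℝ), ∀ x : Fin (n + 1) → X, (∃ i j, R < dist (x i) (x j)) → ψ x = 0) ∧
  (∃ K > (0:ℝ), ∀ x : Fin (n + 1) → X, |ψ x| ≤ K * f (⨆ i, dist (x i) e))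

/-- The boundary operator on chains: `(∂ψ)(x₀,…,xₙ) = ∑_y ψ(y, x₀, …, xₙ)`. -/
noncomputable def bdN {X : Type*} (n : ℕ) (ψ : (Fin (n + 2) → X) → ℝ) :
    (Fin (n + 1) → X) → ℝ :=
  fun x => ∑ᶠ y : X, ψ (Fin.cons y x)

/-- The pushforward of a chain along a map `F : X → Y`:
`(F_*ψ)(ȳ) = ∑_{x̄ : F∘x̄ = ȳ} ψ(x̄)`. -/
noncomputable def pushf {X Y : Type*} (F : X → Y) (n : ℕ)
    (ψ : (Fin (n + 1) → X) → ℝ) : (Fin (n + 1) → Y) → ℝ :=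
  fun y => ∑ᶠ (x : Fin (n + 1) → X) (_ : F ∘ x = y), ψ x

/-- A quasi-isometric embedding. -/
def QIEmb {X Y : Type*} [MetricSpace X] [MetricSpace Y] (F : X → Y) : Prop :=
  ∃ A ≥ (1:ℝ), ∃ B ≥ (0:ℝ), ∀ x y : X,
    A⁻¹ * dist x y - B ≤ dist (F x) (F y) ∧ dist (F x) (F y) ≤ A * dist x y + B

/-- A cycle: any 0-chain, or an `n`-chain with vanishing boundary. -/
def IsCycleN {X : Type*} : (n : ℕ) → ((Fin (n + 1) → X) → ℝ) → Prop
  | 0, _ => True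
  | (n + 1), ψ => bdN n ψ = 0

open Function

theorem finsum_swap {α β : Type*} (g : α → β → ℝ)
    (h : {p : α × β | g p.1 p.2 ≠ 0}.Finite) :
    ∑ᶠ a, ∑ᶠ b, g a b = ∑ᶠ b, ∑ᶠ a, g a b := by
  have h' : HasFiniteSupport fun p : β × α => g p.2 p.1 :=
    (h.preimage Prod.swap_injective.injOn : (Prod.swap ⁻¹' _).Finite)
  rw [← finsum_curry (fun p : α × β => g p.1 p.2) h, ← finsum_curry _ h',
    ← finsum_comp_equiv (Equiv.prodComm β α)]
  rfl

/-- A function on tuples is alternating if permuting the arguments multiplies it by the sign. -/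
def IsAlternatingFun {X : Type*} {m : ℕ} (ψ : (Fin m → X) → ℝ) : Prop :=
  ∀ σ : Equiv.Perm (Fin m), ∀ x : Fin m → X,
    ψ (x ∘ σ) = ((Equiv.Perm.sign σ : ℤ) : ℝ) * ψ x

open Classical in
/-- The value at `z` of the alternating function representing `u₀ ∧ … ∧ uₘ`. -/
noncomputable def wedge {Y : Type*} {m : ℕ} (u z : Fin m → Y) : ℝ :=
  Matrix.det (Matrix.of fun i j => if u i = z j then (1 : ℝ) else 0)

section Wedge

variable {Y : Type*} {m : ℕ}

theorem wedge_comp_left (σ : Equiv.Perm (Fin m)) (u z : Fin m → Y) :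
    wedge (u ∘ σ) z = ((Equiv.Perm.sign σ : ℤ) : ℝ) * wedge u z := by
  rw [wedge, wedge, ← Matrix.det_permute]
  rfl

theorem wedge_comp_right (σ : Equiv.Perm (Fin m)) (u z : Fin m → Y) :
    wedge u (z ∘ σ) = ((Equiv.Perm.sign σ : ℤ) : ℝ) * wedge u z := by
  rw [wedge, wedge, ← Matrix.det_permute']
  rfl

theorem exists_eq_left_of_wedge_ne_zero {u z : Fin m → Y} (h : wedge u z ≠ 0) (i : Fin m) :
    ∃ j, u i = z j := by
  by_contra! hc
  exact h (Matrix.det_eq_zero_of_row_eq_zero i fun j => by simp [hc j])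

theorem exists_eq_right_of_wedge_ne_zero {u z : Fin m → Y} (h : wedge u z ≠ 0) (j : Fin m) :
    ∃ i, u i = z j := by
  by_contra! hc
  exact h (Matrix.det_eq_zero_of_column_eq_zero j fun i => by simp [hc i])

theorem abs_wedge_le (u z : Fin m → Y) : |wedge u z| ≤ m.factorial := by
  have := Matrix.det_le (abv := AbsoluteValue.abs (S := ℝ)) (x := 1)
    (A := Matrix.of fun i j => open Classical in if u i = z j then (1 : ℝ) else 0)
    (fun i j => by
      simp only [Matrix.of_apply, AbsoluteValue.abs_apply]
      split_ifs <;> simp)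
  simpa [wedge] using this

open Classical in
theorem wedge_cons (u : Fin (m + 1) → Y) (y : Y) (z : Fin m → Y) :
    wedge u (Fin.cons y z) =
      ∑ i : Fin (m + 1), if u i = y then (-1) ^ (i : ℕ) * wedge (i.removeNth u) z else 0 := by
  rw [wedge, Matrix.det_succ_column_zero]
  refine Finset.sum_congr rfl fun i _ => ?_
  by_cases h : u i = y
  · simp only [h, Matrix.of_apply, Fin.cons_zero, if_true, mul_one]
    rfl
  · simp [h]

open Classical in
theorem wedge_eq_sum_perm (u z : Fin m → Y) :
    wedge u z = ∑ σ : Equiv.Perm (Fin m),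
      ((Equiv.Perm.sign σ : ℤ) : ℝ) * if u ∘ σ = z then 1 else 0 := by
  rw [wedge, Matrix.det_apply']
  refine Finset.sum_congr rfl fun σ _ => ?_
  congr 1
  simp only [Matrix.of_apply, funext_iff, comp_apply]
  rw [Finset.prod_ite_zero]
  simp

end Wedge

/-- Pushforward along a map of tuples `T`, composed with antisymmetrization. -/
noncomputable def wedgePush {X Y : Type*} {n m : ℕ} (T : (Fin n → X) → Fin m → Y)
    (ψ : (Fin n → X) → ℝ) (z : Fin m → Y) : ℝ :=
  ∑ᶠ x, ψ x * wedge (T x) z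

/-- Only finitely many tuples in the support of `ψ` are sent by `T` to tuples with entries
among those of a given tuple. -/
def FiniteFibers {X Y : Type*} {n m : ℕ} (T : (Fin n → X) → Fin m → Y)
    (ψ : (Fin n → X) → ℝ) : Prop :=
  ∀ z : Fin m → Y, {x | ψ x ≠ 0 ∧ ∀ i, ∃ j, T x i = z j}.Finite

section WedgePush

variable {X Y Z : Type*} {n m : ℕ}

theorem FiniteFibers.finite_wedge {T : (Fin n → X) → Fin m → Y} {ψ : (Fin n → X) → ℝ}
    (h : FiniteFibers T ψ) (z : Fin m → Y) : {x | ψ x * wedge (T x) z ≠ 0}.Finite :=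
  (h z).subset fun _ hx => ⟨left_ne_zero_of_mul hx,
    exists_eq_left_of_wedge_ne_zero (right_ne_zero_of_mul hx)⟩

theorem isAlternatingFun_wedgePush (T : (Fin n → X) → Fin m → Y) (ψ : (Fin n → X) → ℝ) :
    IsAlternatingFun (wedgePush T ψ) := by
  intro σ z
  simp only [wedgePush, wedge_comp_right, mul_finsum]
  exact finsum_congr fun x => by ring

theorem bdN_wedgePush (T : (Fin n → X) → Fin (m + 2) → Y) (ψ : (Fin n → X) → ℝ)
    (h : ∀ i : Fin (m + 2), FiniteFibers (fun x => i.removeNth (T x)) ψ) :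
    bdN m (wedgePush T ψ) = fun z => ∑ i : Fin (m + 2),
      (-1) ^ (i : ℕ) * wedgePush (fun x => i.removeNth (T x)) ψ z := by
  classical
  funext z
  simp only [bdN, wedgePush]
  rw [finsum_swap]
  · simp only [mul_finsum]
    rw [sum_finsum_comm]
    · refine finsum_congr fun x => ?_
      simp only [wedge_cons, ← mul_finsum]
      rw [finsum_sum_comm]
      · rw [Finset.mul_sum]
        refine Finset.sum_congr rfl fun i _ => ?_
        rw [finsum_eq_single _ (T x i) fun y hy => if_neg (Ne.symm hy), if_pos rfl]
        ring
      · intro i _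
        exact (Set.finite_singleton (T x i)).subset fun y hy => by
          by_contra hne
          exact hy (if_neg fun e => hne e.symm)
    · intro i _
      exact ((h i).finite_wedge z).subset fun x hx => right_ne_zero_of_mul hx
  · refine (Set.finite_iUnion fun i : Fin (m + 2) =>
      ((h i).finite_wedge z).image fun x => (T x i, x)).subset ?_
    rintro ⟨y, x⟩ hx
    obtain ⟨i, -, hi⟩ := Finset.exists_ne_zero_of_sum_ne_zero
      (wedge_cons (T x) y z ▸ right_ne_zero_of_mul hx)
    have hy : T x i = y := by
      by_contra hne
      exact hi (if_neg hne)
    rw [if_pos hy] at hi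
    exact Set.mem_iUnion.2 ⟨i, x, mul_ne_zero (left_ne_zero_of_mul hx) (right_ne_zero_of_mul hi),
      by simp [hy]⟩

theorem IsAlternatingFun.insertNth {φ : (Fin (n + 1) → X) → ℝ} (hφ : IsAlternatingFun φ)
    (i : Fin (n + 1)) (y : X) (r : Fin n → X) :
    φ (i.insertNth y r) = (-1) ^ (i : ℕ) * φ (Fin.cons y r) := by
  rw [← Fin.cons_comp_cycleRange, hφ, Fin.sign_cycleRange]
  simp

theorem IsAlternatingFun.finsum_mul_removeNth {φ : (Fin (n + 2) → X) → ℝ}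
    (hφ : IsAlternatingFun φ) (i : Fin (n + 2)) (g : (Fin (n + 1) → X) → ℝ)
    (hfin : {x | φ x * g (i.removeNth x) ≠ 0}.Finite) :
    ∑ᶠ x, φ x * g (i.removeNth x) = (-1) ^ (i : ℕ) * ∑ᶠ r, bdN n φ r * g r := by
  have hfin' : {p : X × (Fin (n + 1) → X) |
      φ (i.insertNth p.1 p.2) * g p.2 ≠ 0}.Finite := by
    refine (hfin.preimage ((Fin.insertNthEquiv (fun _ => X) i).injective.injOn)).subset ?_
    rintro ⟨y, r⟩ hp
    simpa [Fin.insertNthEquiv] using hp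
  rw [← finsum_comp_equiv (Fin.insertNthEquiv (fun _ => X) i)]
  simp only [Fin.insertNthEquiv, Equiv.coe_fn_mk, Fin.removeNth_insertNth]
  rw [finsum_curry (fun p : X × (Fin (n + 1) → X) => φ (i.insertNth p.1 p.2) * g p.2) hfin',
    finsum_swap _ hfin', mul_finsum]
  refine finsum_congr fun r => ?_
  simp only [hφ.insertNth, bdN]
  rw [← finsum_mul, ← mul_finsum, mul_assoc]

theorem pushf_eq_finsum_ite [DecidableEq Y] (P : X → Y) (ψ : (Fin (n + 1) → X) → ℝ)
    (z : Fin (n + 1) → Y) :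
    pushf P n ψ z = ∑ᶠ x, if P ∘ x = z then ψ x else 0 :=
  finsum_congr fun _ => finsum_eq_if

theorem FiniteFibers.finite_comp {P : X → Y} {ψ : (Fin n → X) → ℝ}
    (h : FiniteFibers (P ∘ ·) ψ) (z : Fin n → Y) : {x | ψ x ≠ 0 ∧ P ∘ x = z}.Finite :=
  (h z).subset fun _ hx => ⟨hx.1, fun i => ⟨i, congrFun hx.2 i⟩⟩

theorem IsAlternatingFun.wedgePush_comp {P : X → Y} {ψ : (Fin (n + 1) → X) → ℝ}
    (hψ : IsAlternatingFun ψ) (h : FiniteFibers (P ∘ ·) ψ) :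
    wedgePush (P ∘ ·) ψ = fun z => ((n + 1).factorial : ℝ) * pushf P n ψ z := by
  classical
  funext z
  have key (σ : Equiv.Perm (Fin (n + 1))) (x : Fin (n + 1) → X) :
      ψ x * (((Equiv.Perm.sign σ : ℤ) : ℝ) * if P ∘ x ∘ σ = z then 1 else 0) =
        if P ∘ (x ∘ σ) = z then ψ (x ∘ σ) else 0 := by
    rw [hψ]
    split_ifs <;> ring
  simp only [wedgePush, wedge_eq_sum_perm, Finset.mul_sum, comp_assoc, key]
  rw [finsum_sum_comm]
  · have (σ : Equiv.Perm (Fin (n + 1))) :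
        ∑ᶠ x : Fin (n + 1) → X, (if P ∘ (x ∘ σ) = z then ψ (x ∘ σ) else 0) = pushf P n ψ z := by
      rw [pushf_eq_finsum_ite]
      exact finsum_comp_equiv (Equiv.arrowCongr σ.symm (Equiv.refl X))
        (f := fun x => if P ∘ x = z then ψ x else 0)
    simp [this, Fintype.card_perm]
  · intro σ _
    refine ((h.finite_comp z).preimage
      (Equiv.arrowCongr σ.symm (Equiv.refl X)).injective.injOn).subset fun x hx => ?_
    have hx : (if P ∘ (x ∘ σ) = z then ψ (x ∘ σ) else 0) ≠ 0 := hx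
    rw [ite_ne_right_iff] at hx
    exact ⟨hx.2, hx.1⟩

theorem IsAlternatingFun.pushf_eq {P : X → Y} {ψ : (Fin (n + 1) → X) → ℝ}
    (hψ : IsAlternatingFun ψ) (h : FiniteFibers (P ∘ ·) ψ) :
    pushf P n ψ = fun z => ((n + 1).factorial : ℝ)⁻¹ * wedgePush (P ∘ ·) ψ z := by
  have : ((n + 1).factorial : ℝ) ≠ 0 := by positivity
  funext z
  rw [hψ.wedgePush_comp h, inv_mul_cancel_left₀ this]

theorem pushf_comp (P : X → Y) (Q : Y → Z) (ψ : (Fin (n + 1) → X) → ℝ)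
    (h : FiniteFibers ((Q ∘ P) ∘ ·) ψ) :
    pushf Q n (pushf P n ψ) = pushf (Q ∘ P) n ψ := by
  classical
  funext z
  simp only [pushf_eq_finsum_ite]
  have e (y : Fin (n + 1) → Y) :
      (if Q ∘ y = z then ∑ᶠ x, (if P ∘ x = y then ψ x else 0) else 0) =
        ∑ᶠ x, if y = P ∘ x then (if (Q ∘ P) ∘ x = z then ψ x else 0) else 0 := by
    split_ifs with hy
    · refine finsum_congr fun x => ?_
      by_cases hx : P ∘ x = y
      · subst hx
        simp [comp_assoc, hy]
      · rw [if_neg hx, if_neg (Ne.symm hx)]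
    · symm
      convert finsum_zero with x
      split_ifs with h1 h2
      · subst h1
        exact absurd h2 hy
      · rfl
      · rfl
  simp only [e]
  rw [finsum_swap]
  · refine finsum_congr fun x => ?_
    rw [finsum_eq_single _ (P ∘ x) fun y hy => if_neg hy, if_pos rfl]
  · refine ((h.finite_comp z).image fun x => (P ∘ x, x)).subset ?_
    rintro ⟨y, x⟩ hx
    simp only [Set.mem_ofPred_eq, ite_ne_right_iff] at hx
    exact ⟨x, ⟨hx.2.2, hx.2.1⟩, by simp [hx.1]⟩

theorem pushf_id (ψ : (Fin (n + 1) → X) → ℝ) : pushf id n ψ = ψ := by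
  classical
  funext z
  rw [pushf_eq_finsum_ite, finsum_eq_single _ z fun y hy => if_neg (by simpa using hy)]
  simp

end WedgePush

theorem IsControlFun.exists_affine_le {f : ℝ → ℝ} (hf : IsControlFun f) {A c : ℝ} (hA : 0 < A)
    (hc : 0 ≤ c) : ∃ L > 0, ∀ t, 0 ≤ t → f (A * t + c) ≤ L * f t := by
  obtain ⟨L₁, hL₁, h₁⟩ := hf.shift (c + 1) (by linarith)
  obtain ⟨L₂, hL₂, h₂⟩ := hf.scale A hA
  have hfc := hf.nonneg c hc
  refine ⟨L₁ * L₂ + f c, by positivity, fun t ht => ?_⟩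
  rcases ht.eq_or_lt with rfl | ht
  · rw [mul_zero, zero_add, hf.one_at_zero, mul_one]
    have := mul_pos hL₁ hL₂
    linarith
  · have hAt : 0 < A * t := mul_pos hA ht
    calc f (A * t + c) ≤ f (A * t + (c + 1)) := hf.mono _ _ (by positivity) (by linarith)
      _ ≤ L₁ * f (A * t) := h₁ _ hAt
      _ ≤ L₁ * (L₂ * f t) := by gcongr; exact h₂ t ht
      _ ≤ (L₁ * L₂ + f c) * f t := by nlinarith [mul_nonneg hfc (hf.nonneg t ht.le)]

theorem bdN_smul {X : Type*} {n : ℕ} (c : ℝ) (φ : (Fin (n + 2) → X) → ℝ) : bdN n (c • φ) = c • bdN n φ := by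
  funext x
  simp only [bdN, Pi.smul_apply, smul_eq_mul, mul_finsum]

theorem abs_wedgePush_le {X Y : Type*} {n m : ℕ} {T : (Fin (n + 1) → X) → Fin (m + 1) → Y}
    {ψ : (Fin (n + 1) → X) → ℝ} {z : Fin (m + 1) → Y} {S : Finset (Fin (n + 1) → X)} {M : ℝ}
    (hS : ∀ x, ψ x * wedge (T x) z ≠ 0 → x ∈ S)
    (hM : ∀ x, ψ x * wedge (T x) z ≠ 0 → |ψ x| ≤ M) (hM0 : 0 ≤ M) :
    |wedgePush T ψ z| ≤ S.card * (M * (m + 1).factorial) := by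
  rw [wedgePush, finsum_eq_sum_of_support_subset _ hS, ← nsmul_eq_mul]
  refine (Finset.abs_sum_le_sum_abs _ _).trans (Finset.sum_le_card_nsmul _ _ _ fun x _ => ?_)
  by_cases hx : ψ x * wedge (T x) z = 0
  · rw [hx, abs_zero]
    positivity
  · rw [abs_mul]
    exact mul_le_mul (hM x hx) (abs_wedge_le _ _) (abs_nonneg _) hM0

/-- Every entry of `T x` is within `D` of the image under `F` of an entry of `x`. -/
def TupleNear {X Y : Type*} [MetricSpace Y] (F : X → Y) (D : ℝ) {n m : ℕ} (T : (Fin n → X) → Fin m → Y) : Prop :=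
  ∀ x i, ∃ a, dist (T x i) (F (x a)) ≤ D

theorem TupleNear.removeNth {X Y : Type*} [MetricSpace Y] {F : X → Y} {D : ℝ} {n m : ℕ}
    {T : (Fin n → X) → Fin (m + 1) → Y}
    (hT : TupleNear F D T) (i : Fin (m + 1)) : TupleNear F D fun x => i.removeNth (T x) :=
  fun x j => hT x (i.succAbove j)

theorem tupleNear_comp {X Y : Type*} [MetricSpace Y] {F P : X → Y} {D : ℝ}
    (h : ∀ x, dist (P x) (F x) ≤ D) (n : ℕ) :
    TupleNear F D ((P ∘ ·) : (Fin n → X) → Fin n → Y) :=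
  fun x i => ⟨i, h (x i)⟩

section Metric

variable {X Y : Type*} [MetricSpace X] [MetricSpace Y]

theorem QIEmb.exists_finset_preimage {F : X → Y} (hF : QIEmb F) (hX : BddGeom X) (D : ℝ) :
    ∃ N : ℕ, ∀ w : Y, ∃ S : Finset X, S.card ≤ N ∧ ∀ x, dist (F x) w ≤ D → x ∈ S := by
  obtain ⟨A, hA, B, hB, h⟩ := hF
  obtain ⟨N, hN⟩ := hX (A * (2 * |D| + B) + 1) (by positivity)
  refine ⟨N, fun w => ?_⟩
  by_cases hw : ∃ x₀, dist (F x₀) w ≤ D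
  · obtain ⟨x₀, hx₀⟩ := hw
    obtain ⟨hfin, hcard⟩ := hN x₀
    refine ⟨hfin.toFinset, by rwa [← Set.ncard_eq_toFinset_card _ hfin], fun x hx => ?_⟩
    rw [Set.Finite.mem_toFinset, Metric.mem_closedBall]
    have h1 := (h x x₀).1
    have h2 := dist_triangle_right (F x) (F x₀) w
    have h3 : A⁻¹ * dist x x₀ ≤ 2 * |D| + B := by linarith [le_abs_self D]
    rw [inv_mul_le_iff₀ (by linarith)] at h3
    linarith
  · exact ⟨∅, by simp, fun x hx => (hw ⟨x, hx⟩).elim⟩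

/-- `ψ` vanishes on tuples of diameter larger than `R`. -/
def HasPropagation {n : ℕ} (R : ℝ) (ψ : (Fin n → X) → ℝ) : Prop :=
  ∀ x, (∃ i j, R < dist (x i) (x j)) → ψ x = 0

variable {n m : ℕ} {F : X → Y} {D R : ℝ} {T : (Fin (n + 1) → X) → Fin (m + 1) → Y}
  {ψ : (Fin (n + 1) → X) → ℝ}

theorem TupleNear.exists_uniform {k : ℕ} {T : (Fin (n + 1) → X) → Fin k → Y}
    (hT : TupleNear F D T) (hF : QIEmb F) (hR : HasPropagation R ψ) :
    ∃ D', ∀ x, ψ x ≠ 0 → ∀ i a, dist (T x i) (F (x a)) ≤ D' := by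
  obtain ⟨A, hA, B, hB, h⟩ := hF
  refine ⟨D + (A * R + B), fun x hx i a => ?_⟩
  obtain ⟨b, hb⟩ := hT x i
  have hab : dist (x b) (x a) ≤ R := by
    by_contra! hlt
    exact hx (hR x ⟨b, a, hlt⟩)
  have h1 := (h (x b) (x a)).2
  have h2 : A * dist (x b) (x a) ≤ A * R := by gcongr
  linarith [dist_triangle (T x i) (F (x b)) (F (x a))]

theorem TupleNear.exists_card_le (hT : TupleNear F D T) (hF : QIEmb F) (hX : BddGeom X)
    (hR : HasPropagation R ψ) :
    ∃ N : ℕ, ∀ z : Fin (m + 1) → Y, ∃ S : Finset (Fin (n + 1) → X), S.card ≤ N ∧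
      ∀ x, ψ x ≠ 0 → (∀ i, ∃ j, T x i = z j) → x ∈ S := by
  classical
  obtain ⟨D', hD'⟩ := hT.exists_uniform hF hR
  obtain ⟨N, hN⟩ := hF.exists_finset_preimage hX D'
  choose S hS hmem using hN
  refine ⟨((m + 1) * N) ^ (n + 1), fun z =>
    ⟨Fintype.piFinset fun _ => Finset.univ.biUnion fun j => S (z j), ?_, fun x hx hz => ?_⟩⟩
  · rw [Fintype.card_piFinset_const]
    gcongr
    refine (Finset.card_biUnion_le_card_mul _ _ N fun j _ => hS _).trans ?_
    simp
  · rw [Fintype.mem_piFinset]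
    intro a
    obtain ⟨j, hj⟩ := hz 0
    refine Finset.mem_biUnion.2 ⟨j, Finset.mem_univ _, hmem _ _ ?_⟩
    rw [← hj, dist_comm]
    exact hD' x hx 0 a

theorem TupleNear.finiteFibers (hT : TupleNear F D T) (hF : QIEmb F) (hX : BddGeom X)
    (hR : HasPropagation R ψ) : FiniteFibers T ψ := by
  obtain ⟨N, hN⟩ := hT.exists_card_le hF hX hR
  intro z
  obtain ⟨S, -, hS⟩ := hN z
  exact S.finite_toSet.subset fun x hx => hS x hx.1 hx.2

theorem IsNChain.wedgePush {f : ℝ → ℝ} (hf : IsControlFun f) {eX : X} (eY : Y)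
    (hψ : IsNChain eX f n ψ) (hT : TupleNear F D T) (hF : QIEmb F) (hX : BddGeom X) :
    IsNChain eY f m (wedgePush T ψ) := by
  obtain ⟨-, ⟨R, -, hR⟩, K, hK, hψK⟩ := hψ
  have hR : HasPropagation R ψ := hR
  obtain ⟨D', hD'⟩ := hT.exists_uniform hF hR
  obtain ⟨N, hN⟩ := hT.exists_card_le hF hX hR
  refine ⟨isAlternatingFun_wedgePush T ψ, ⟨|D'| + |D'| + 1, by positivity, ?_⟩, ?_⟩
  · rintro z ⟨i, j, hij⟩
    rw [_root_.wedgePush]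
    refine (finsum_congr fun x => ?_).trans finsum_zero
    by_contra hx
    have hw := right_ne_zero_of_mul hx
    obtain ⟨i', hi'⟩ := exists_eq_right_of_wedge_ne_zero hw i
    obtain ⟨j', hj'⟩ := exists_eq_right_of_wedge_ne_zero hw j
    have h1 := hD' x (left_ne_zero_of_mul hx) i' 0
    have h2 := hD' x (left_ne_zero_of_mul hx) j' 0
    rw [hi'] at h1
    rw [hj'] at h2
    linarith [dist_triangle_right (z i) (z j) (F (x 0)), le_abs_self D']
  · obtain ⟨A, hA, B, hB, h⟩ := hF
    have hA0 : 0 < A := by linarith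
    obtain ⟨L, hL, hfL⟩ := hf.exists_affine_le hA0
      (c := A * (|D'| + dist eY (F eX) + B)) (by positivity)
    refine ⟨N * (K * L * (m + 1).factorial) + 1, by positivity, fun z => ?_⟩
    obtain ⟨S, hSN, hS⟩ := hN z
    set s := ⨆ j, dist (z j) eY with hs
    have hs0 : 0 ≤ s := Real.iSup_nonneg fun j => dist_nonneg
    have hfs := hf.nonneg s hs0
    have hbound : ∀ x, ψ x * wedge (T x) z ≠ 0 → |ψ x| ≤ K * (L * f s) := by
      intro x hx
      refine (hψK x).trans ?_
      gcongr
      refine (hf.mono _ _ (Real.iSup_nonneg fun j => dist_nonneg) (ciSup_le fun a => ?_)).trans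
        (hfL s hs0)
      obtain ⟨j, hj⟩ := exists_eq_left_of_wedge_ne_zero (right_ne_zero_of_mul hx) 0
      have h1 := hD' x (left_ne_zero_of_mul hx) 0 a
      rw [hj, dist_comm] at h1
      have h2 : dist (z j) eY ≤ s := le_ciSup (f := fun j => dist (z j) eY)
        (Set.finite_range _).bddAbove j
      have h3 := (h (x a) eX).1
      have h4 := dist_triangle4 (F (x a)) (z j) eY (F eX)
      have h5 : A⁻¹ * dist (x a) eX ≤ s + (|D'| + dist eY (F eX) + B) := by
        linarith [le_abs_self D']
      rw [inv_mul_le_iff₀ hA0] at h5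
      linarith
    refine (abs_wedgePush_le (fun x hx => hS x (left_ne_zero_of_mul hx)
      (exists_eq_left_of_wedge_ne_zero (right_ne_zero_of_mul hx))) hbound
      (by positivity)).trans ?_
    have hSN' : (S.card : ℝ) ≤ N := by exact_mod_cast hSN
    calc (S.card : ℝ) * (K * (L * f s) * (m + 1).factorial)
        ≤ N * (K * (L * f s) * (m + 1).factorial) := by gcongr
      _ ≤ (N * (K * L * (m + 1).factorial) + 1) * f s := by linarith

/-- The `f`-controlled `n`-chains form a real vector space. -/
def nChains {f : ℝ → ℝ} (hf : IsControlFun f) (e : X) (n : ℕ) :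
    Submodule ℝ ((Fin (n + 1) → X) → ℝ) where
  carrier := {ψ | IsNChain e f n ψ}
  zero_mem' := by
    refine ⟨fun _ _ => by simp, ⟨1, one_pos, fun _ _ => rfl⟩, 1, one_pos, fun x => ?_⟩
    have := hf.nonneg (⨆ i, dist (x i) e) (Real.iSup_nonneg fun j => dist_nonneg)
    simpa using this
  add_mem' := by
    rintro φ ψ ⟨ha, ⟨R, hR, hp⟩, K, hK, hb⟩ ⟨ha', ⟨R', hR', hp'⟩, K', hK', hb'⟩
    refine ⟨fun σ x => ?_, ⟨max R R', lt_max_of_lt_left hR, ?_⟩, K + K', by positivity,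
      fun x => ?_⟩
    · simp only [Pi.add_apply, ha σ x, ha' σ x, mul_add]
    · rintro x ⟨i, j, hij⟩
      rw [Pi.add_apply, hp x ⟨i, j, (le_max_left _ _).trans_lt hij⟩,
        hp' x ⟨i, j, (le_max_right _ _).trans_lt hij⟩, add_zero]
    · rw [add_mul]
      exact (abs_add_le _ _).trans (add_le_add (hb x) (hb' x))
  smul_mem' := by
    rintro c ψ ⟨ha, ⟨R, hR, hp⟩, K, hK, hb⟩
    refine ⟨fun σ x => ?_, ⟨R, hR, fun x hx => ?_⟩, (|c| + 1) * K, by positivity, fun x => ?_⟩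
    · simp only [Pi.smul_apply, ha σ x, smul_eq_mul]
      ring
    · rw [Pi.smul_apply, hp x hx, smul_zero]
    · rw [Pi.smul_apply, smul_eq_mul, abs_mul, mul_assoc]
      exact mul_le_mul (by linarith) (hb x) (abs_nonneg _) (by positivity)

theorem IsNChain.exists_hasPropagation {f : ℝ → ℝ} {e : X} (hψ : IsNChain e f n ψ) :
    ∃ R, HasPropagation R ψ :=
  let ⟨R, _, hR⟩ := hψ.2.1
  ⟨R, hR⟩

theorem IsNChain.isAlternatingFun {f : ℝ → ℝ} {e : X} (hψ : IsNChain e f n ψ) :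
    IsAlternatingFun ψ :=
  hψ.1

theorem IsNChain.finite_cons {f : ℝ → ℝ} {e : X} {φ : (Fin (n + 2) → X) → ℝ}
    (hφ : IsNChain e f (n + 1) φ) (hX : BddGeom X) (x : Fin (n + 1) → X) :
    HasFiniteSupport fun y => φ (Fin.cons y x) := by
  obtain ⟨-, ⟨R, hR, hp⟩, -⟩ := hφ
  obtain ⟨N, hN⟩ := hX R hR
  refine (hN (x 0)).1.subset fun y hy => ?_
  rw [Metric.mem_closedBall]
  by_contra! hlt
  exact hy (hp _ ⟨0, 1, hlt⟩)

theorem bdN_sum {ι : Type*} (s : Finset ι) {f : ℝ → ℝ} {e : X}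
    {φ : ι → (Fin (n + 2) → X) → ℝ} (hφ : ∀ i ∈ s, IsNChain e f (n + 1) (φ i))
    (hX : BddGeom X) : bdN n (∑ i ∈ s, φ i) = ∑ i ∈ s, bdN n (φ i) := by
  funext x
  simp only [bdN, Finset.sum_apply]
  exact finsum_sum_comm _ _ fun i hi => (hφ i hi).finite_cons hX x

theorem bdN_sub {f : ℝ → ℝ} {e : X} {φ φ' : (Fin (n + 2) → X) → ℝ}
    (hφ : IsNChain e f (n + 1) φ) (hφ' : IsNChain e f (n + 1) φ') (hX : BddGeom X) :
    bdN n (φ - φ') = bdN n φ - bdN n φ' := by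
  funext x
  exact finsum_sub_distrib (hφ.finite_cons hX x) (hφ'.finite_cons hX x)

theorem IsNChain.pushf {f : ℝ → ℝ} (hf : IsControlFun f) {eX : X} (eY : Y)
    (hψ : IsNChain eX f n ψ) (hF : QIEmb F) (hX : BddGeom X) :
    IsNChain eY f n (pushf F n ψ) := by
  obtain ⟨R, hR⟩ := hψ.exists_hasPropagation
  have hT : TupleNear F 0 ((F ∘ ·) : (Fin (n + 1) → X) → _) :=
    tupleNear_comp (fun x => (dist_self _).le) _
  rw [hψ.isAlternatingFun.pushf_eq (hT.finiteFibers hF hX hR)]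
  exact (nChains hf eY n).smul_mem _ (hψ.wedgePush hf eY hT hF hX)

theorem pushf_bdN {f : ℝ → ℝ} {eX : X} {φ : (Fin (n + 2) → X) → ℝ}
    (hφ : IsNChain eX f (n + 1) φ) (hF : QIEmb F) (hX : BddGeom X) :
    _root_.pushf F n (bdN n φ) = bdN n (_root_.pushf F (n + 1) φ) := by
  classical
  obtain ⟨R, hR⟩ := hφ.exists_hasPropagation
  have hT : TupleNear F 0 ((F ∘ ·) : (Fin (n + 2) → X) → _) :=
    tupleNear_comp (fun x => (dist_self _).le) _
  funext z
  have hfin : {x | φ x ≠ 0 ∧ F ∘ (0 : Fin (n + 2)).removeNth x = z}.Finite :=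
    ((hT.removeNth 0).finiteFibers hF hX hR z).subset fun x hx =>
      ⟨hx.1, fun i => ⟨i, congrFun hx.2 i⟩⟩
  have h0 := hφ.isAlternatingFun.finsum_mul_removeNth 0 (fun r => if F ∘ r = z then 1 else 0)
    (hfin.subset fun x hx => ⟨left_ne_zero_of_mul hx, by
      by_contra hne
      exact right_ne_zero_of_mul hx (if_neg hne)⟩)
  simp only [mul_ite, mul_one, mul_zero, Fin.val_zero, pow_zero, one_mul] at h0
  rw [pushf_eq_finsum_ite, ← h0]
  simp only [bdN, pushf_eq_finsum_ite]
  have e (y : Y) (x : Fin (n + 2) → X) : (if F ∘ x = Fin.cons y z then φ x else 0) =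
      if y = F (x 0) then (if F ∘ (0 : Fin (n + 2)).removeNth x = z then φ x else 0) else 0 := by
    rw [← ite_and]
    refine if_congr ?_ rfl rfl
    simp [funext_iff, Fin.forall_fin_succ, Fin.tail, eq_comm (a := y)]
  simp only [e]
  rw [finsum_swap]
  · refine finsum_congr fun x => ?_
    rw [finsum_eq_single _ (F (x 0)) fun y hy => if_neg hy, if_pos rfl]
  · refine (hfin.image fun x => (F (x 0), x)).subset ?_
    rintro ⟨y, x⟩ hx
    simp only [Set.mem_ofPred_eq, ite_ne_right_iff] at hx
    exact ⟨x, ⟨hx.2.2, hx.2.1⟩, by simp [hx.1]⟩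

end Metric

section Prism

variable {X Y : Type*} {n : ℕ}

/-- The tuple whose first `k` entries are given by `F` and whose others are given by `G`. -/
def mixTuple (F G : X → Y) (k : ℕ) (x : Fin n → X) (i : Fin n) : Y :=
  if (i : ℕ) < k then F (x i) else G (x i)

/-- The tuple `(F xₖ, F x₀, …, F xₖ₋₁, G xₖ, …, G xₙ)`, a permuted simplex of the prism
between the tuples `F ∘ x` and `G ∘ x`. -/
def prismTuple (F G : X → Y) (k : Fin n) (x : Fin n → X) : Fin (n + 1) → Y :=
  Fin.cons (F (x k)) (mixTuple F G k x)

theorem mixTuple_zero (F G : X → Y) : mixTuple (n := n) F G 0 = (G ∘ ·) := by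
  funext x i
  simp [mixTuple]

theorem mixTuple_self (F G : X → Y) : mixTuple (n := n) F G n = (F ∘ ·) := by
  funext x i
  simp [mixTuple]

theorem removeNth_zero_prismTuple (F G : X → Y) (k : Fin n) (x : Fin n → X) :
    (0 : Fin (n + 1)).removeNth (prismTuple F G k x) = mixTuple F G k x := by
  funext i
  simp [prismTuple, Fin.removeNth_apply]

theorem removeNth_succ_prismTuple (F G : X → Y) (k : Fin (n + 1)) (x : Fin (n + 1) → X) :
    k.succ.removeNth (prismTuple F G k x) = mixTuple F G (k + 1) x ∘ k.cycleRange.symm := by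
  rw [← Fin.cons_removeNth_eq_comp_cycleRange_symm]
  funext i
  cases i using Fin.cases with
  | zero => simp [prismTuple, mixTuple, Fin.removeNth_apply]
  | succ i =>
    have h : (k.succAbove i : ℕ) ≠ k := fun h => k.succAbove_ne i (Fin.ext h)
    have h' : (k.succAbove i : ℕ) < k ↔ (k.succAbove i : ℕ) < k + 1 := by omega
    simp [prismTuple, mixTuple, Fin.removeNth_apply, h']

theorem removeNth_succ_prismTuple_insertNth (F G : X → Y) {j k : Fin (n + 2)} (hjk : j ≠ k) (e : X)
    (x : Fin (n + 2) → X) :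
    j.succ.removeNth (prismTuple F G k (j.insertNth e (j.removeNth x))) =
      j.succ.removeNth (prismTuple F G k x) := by
  rw [Fin.insertNth_removeNth]
  funext i
  cases i using Fin.cases with
  | zero => simp [prismTuple, Fin.removeNth_apply, hjk.symm]
  | succ i => simp [prismTuple, mixTuple, Fin.removeNth_apply]

theorem wedgePush_removeNth_prismTuple (F G : X → Y) {j k : Fin (n + 1)} (hjk : j ≠ k)
    {ψ : (Fin (n + 1) → X) → ℝ} (hψ : IsAlternatingFun ψ) (hcyc : IsCycleN n ψ)
    (hfin : FiniteFibers (fun x => j.succ.removeNth (prismTuple F G k x)) ψ) :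
    wedgePush (fun x => j.succ.removeNth (prismTuple F G k x)) ψ = 0 := by
  cases n with
  | zero => exact (hjk (Subsingleton.elim (α := Fin 1) _ _)).elim
  | succ n =>
    funext z
    rcases isEmpty_or_nonempty X with hX | ⟨⟨e⟩⟩
    · exact finsum_of_isEmpty _
    have hfz := hfin.finite_wedge z
    have hsum := hψ.finsum_mul_removeNth j
      (fun r => wedge (j.succ.removeNth (prismTuple F G k (j.insertNth e r))) z)
    simp only [removeNth_succ_prismTuple_insertNth F G hjk e] at hsum
    rw [wedgePush, hsum hfz, show bdN n ψ = 0 from hcyc]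
    simp

variable [MetricSpace Y] {F G : X → Y} {D : ℝ}

theorem tupleNear_mixTuple (h : ∀ x, dist (G x) (F x) ≤ D) (k : ℕ) :
    TupleNear F D (mixTuple (n := n) F G k) := by
  intro x i
  refine ⟨i, ?_⟩
  rw [mixTuple]
  split_ifs
  · rw [dist_self]
    exact dist_nonneg.trans (h (x i))
  · exact h (x i)

theorem tupleNear_prismTuple (h : ∀ x, dist (G x) (F x) ≤ D) (k : Fin n) :
    TupleNear F D (prismTuple F G k) := by
  intro x i
  cases i using Fin.cases with
  | zero => exact ⟨k, by simpa [prismTuple] using dist_nonneg.trans (h (x k))⟩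
  | succ i => simpa [prismTuple] using tupleNear_mixTuple h k x i

theorem bdN_wedgePush_prismTuple [MetricSpace X] (hF : QIEmb F) (hX : BddGeom X)
    (h : ∀ x, dist (G x) (F x) ≤ D) {f : ℝ → ℝ} {e : X} {ψ : (Fin (n + 1) → X) → ℝ}
    (hψ : IsNChain e f n ψ) (hcyc : IsCycleN n ψ) (k : Fin (n + 1)) :
    bdN n (wedgePush (prismTuple F G k) ψ) =
      wedgePush (mixTuple F G k) ψ - wedgePush (mixTuple F G (k + 1)) ψ := by
  obtain ⟨R, hR⟩ := hψ.exists_hasPropagation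
  have hfin (i : Fin (n + 2)) :=
    ((tupleNear_prismTuple h k).removeNth i).finiteFibers hF hX hR
  rw [bdN_wedgePush _ _ hfin]
  funext z
  rw [Fin.sum_univ_succ, Finset.sum_eq_single k]
  · have hk : wedgePush (fun x => k.succ.removeNth (prismTuple F G k x)) ψ z =
        (-1) ^ (k : ℕ) * wedgePush (mixTuple F G (k + 1)) ψ z := by
      simp only [wedgePush, removeNth_succ_prismTuple, wedge_comp_left, mul_finsum,
        Equiv.Perm.sign_symm, Fin.sign_cycleRange]
      refine finsum_congr fun x => ?_
      push_cast
      ring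
    rw [hk]
    simp only [removeNth_zero_prismTuple, Fin.val_zero, pow_zero, one_mul, Fin.val_succ, pow_succ,
      Pi.sub_apply]
    have hsign : (-1 : ℝ) ^ (k : ℕ) * (-1) ^ (k : ℕ) = 1 := by rw [← mul_pow]; norm_num
    linear_combination -wedgePush (mixTuple F G (k + 1)) ψ z * hsign
  · intro j _ hjk
    rw [wedgePush_removeNth_prismTuple F G hjk hψ.isAlternatingFun hcyc (hfin j.succ)]
    simp
  · simp

/-- Pushforwards of a controlled cycle along close maps are homologous. -/
theorem exists_pushf_sub_pushf_eq_bdN [MetricSpace X] (hF : QIEmb F) (hX : BddGeom X)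
    (hY : BddGeom Y) (h : ∀ x, dist (G x) (F x) ≤ D) {f : ℝ → ℝ} (hf : IsControlFun f) {eX : X}
    (eY : Y) {ψ : (Fin (n + 1) → X) → ℝ} (hψ : IsNChain eX f n ψ) (hcyc : IsCycleN n ψ) :
    ∃ φ, IsNChain eY f (n + 1) φ ∧ pushf G n ψ - pushf F n ψ = bdN n φ := by
  obtain ⟨R, hR⟩ := hψ.exists_hasPropagation
  have hP (k : Fin (n + 1)) : IsNChain eY f (n + 1) (wedgePush (prismTuple F G k) ψ) :=
    hψ.wedgePush hf eY (tupleNear_prismTuple h k) hF hX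
  refine ⟨((n + 1).factorial : ℝ)⁻¹ • ∑ k : Fin (n + 1), wedgePush (prismTuple F G k) ψ,
    (nChains hf eY (n + 1)).smul_mem _ (Submodule.sum_mem _ fun k _ => hP k), ?_⟩
  have hFF : FiniteFibers ((F ∘ ·) : (Fin (n + 1) → X) → _) ψ :=
    (tupleNear_comp (D := 0) (fun x => (dist_self _).le) _).finiteFibers hF hX hR
  have hGF : FiniteFibers ((G ∘ ·) : (Fin (n + 1) → X) → _) ψ :=
    (tupleNear_comp h _).finiteFibers hF hX hR
  rw [bdN_smul, bdN_sum _ (fun k _ => hP k) hY]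
  simp only [bdN_wedgePush_prismTuple hF hX h hψ hcyc]
  rw [Fin.sum_univ_eq_sum_range
    (fun k => wedgePush (mixTuple F G k) ψ - wedgePush (mixTuple F G (k + 1)) ψ),
    Finset.sum_range_sub', mixTuple_zero, mixTuple_self, hψ.isAlternatingFun.pushf_eq hFF,
    hψ.isAlternatingFun.pushf_eq hGF, smul_sub]
  rfl

end Prism

section QuasiInverse

variable {X Y : Type*} [MetricSpace X] [MetricSpace Y]

theorem qiEmb_id : QIEmb (id : X → X) :=
  ⟨1, le_rfl, 0, le_rfl, fun x y => by simp⟩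

theorem QIEmb.exists_quasi_inverse {F : X → Y} (hF : QIEmb F)
    (honto : ∃ C ≥ (0 : ℝ), ∀ y : Y, ∃ x : X, dist (F x) y ≤ C) :
    ∃ G : Y → X, QIEmb G ∧ (∃ D, ∀ x, dist (G (F x)) x ≤ D) ∧
      ∃ D, ∀ y, dist (F (G y)) y ≤ D := by
  obtain ⟨C, hC, hG⟩ := honto
  choose G hG using hG
  obtain ⟨A, hA, B, hB, h⟩ := hF
  have hA0 : 0 < A := by linarith
  refine ⟨G, ⟨A, hA, A * (2 * C + B), by positivity, fun y y' => ⟨?_, ?_⟩⟩,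
    ⟨A * (C + B), fun x => ?_⟩, C, hG⟩
  · have h1 := (h (G y) (G y')).2
    have h2 := dist_triangle4_right y y' (F (G y)) (F (G y'))
    rw [dist_comm y (F _), dist_comm y' (F _)] at h2
    have h3 : A⁻¹ * dist y y' ≤ A⁻¹ * (A * dist (G y) (G y') + (2 * C + B)) := by
      gcongr
      linarith [hG y, hG y']
    rw [mul_add, inv_mul_cancel_left₀ hA0.ne'] at h3
    have h4 : A⁻¹ * (2 * C + B) ≤ A * (2 * C + B) := by
      gcongr
      exact (inv_le_one_of_one_le₀ hA).trans hA
    linarith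
  · have h1 := (h (G y) (G y')).1
    have h2 := dist_triangle4 (F (G y)) y y' (F (G y'))
    rw [dist_comm y' (F _)] at h2
    have h3 : A⁻¹ * dist (G y) (G y') ≤ dist y y' + (2 * C + B) := by
      linarith [hG y, hG y']
    rw [inv_mul_le_iff₀ hA0] at h3
    linarith
  · have h1 := (h (G (F x)) x).1
    have h3 : A⁻¹ * dist (G (F x)) x ≤ C + B := by linarith [hG (F x)]
    rwa [inv_mul_le_iff₀ hA0] at h3

theorem IsCycleN.pushf {n : ℕ} {f : ℝ → ℝ} {e : X} {F : X → Y} {ψ : (Fin (n + 1) → X) → ℝ}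
    (hcyc : IsCycleN n ψ) (hψ : IsNChain e f n ψ) (hF : QIEmb F) (hX : BddGeom X) :
    IsCycleN n (pushf F n ψ) := by
  cases n with
  | zero => trivial
  | succ n =>
    change bdN n (_root_.pushf F (n + 1) ψ) = 0
    rw [← pushf_bdN hψ hF hX, show bdN n ψ = 0 from hcyc]
    funext z
    simp [_root_.pushf]

end QuasiInverse

/-- A self-map at bounded distance from the identity acts trivially on controlled homology,
where the self-map is given as a composition. -/
theorem exists_pushf_pushf_eq_add_bdN {X Y : Type*} [MetricSpace X] {n : ℕ} {f : ℝ → ℝ} (hf : IsControlFun f) {e : X}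
    {F : X → Y} {G : Y → X} {D : ℝ} (hX : BddGeom X) (h : ∀ x, dist (G (F x)) x ≤ D)
    {ψ : (Fin (n + 1) → X) → ℝ} (hψ : IsNChain e f n ψ) (hcyc : IsCycleN n ψ) :
    ∃ φ, IsNChain e f (n + 1) φ ∧ pushf G n (pushf F n ψ) = ψ + bdN n φ := by
  obtain ⟨R, hR⟩ := hψ.exists_hasPropagation
  obtain ⟨φ, hφ, he⟩ := exists_pushf_sub_pushf_eq_bdN (F := id) (G := G ∘ F) qiEmb_id hX hX h hf e
    hψ hcyc
  refine ⟨φ, hφ, ?_⟩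
  rw [← he, pushf_id, add_sub_cancel, pushf_comp]
  exact (tupleNear_comp (F := id) h _).finiteFibers qiEmb_id hX hR

/-- A quasi-isometry induces an isomorphism
`H_n^f(X) ≅ H_n^f(Y)` for every `n`: the pushforward maps controlled cycles to
controlled cycles, is a chain map, and is injective and surjective on homology. -/
theorem quasi_isometry_induces_iso_on_controlled_homology
    {X Y : Type*} [MetricSpace X] [MetricSpace Y] (eX : X) (eY : Y) (f : ℝ → ℝ)
    (hudX : UnifDiscrete X) (hbgX : BddGeom X)
    (hudY : UnifDiscrete Y) (hbgY : BddGeom Y)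
    (hf : IsControlFun f)
    (F : X → Y) (hF : QIEmb F)
    (honto : ∃ C ≥ (0:ℝ), ∀ y : Y, ∃ x : X, dist (F x) y ≤ C)
    (n : ℕ) :
    (∀ ψ : (Fin (n + 1) → X) → ℝ, IsNChain eX f n ψ →
      IsNChain eY f n (pushf F n ψ) ∧
      (IsCycleN n ψ → IsCycleN n (pushf F n ψ))) ∧
    (∀ φ : (Fin (n + 2) → X) → ℝ, IsNChain eX f (n + 1) φ →
      pushf F n (bdN n φ) = bdN n (pushf F (n + 1) φ)) ∧
    (∀ ψ : (Fin (n + 1) → X) → ℝ, IsNChain eX f n ψ → IsCycleN n ψ →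
      (∃ φ : (Fin (n + 2) → Y) → ℝ, IsNChain eY f (n + 1) φ ∧
        pushf F n ψ = bdN n φ) →
      ∃ φ' : (Fin (n + 2) → X) → ℝ, IsNChain eX f (n + 1) φ' ∧ ψ = bdN n φ') ∧
    (∀ ζ : (Fin (n + 1) → Y) → ℝ, IsNChain eY f n ζ → IsCycleN n ζ →
      ∃ ψ : (Fin (n + 1) → X) → ℝ, ∃ φ : (Fin (n + 2) → Y) → ℝ,
        IsNChain eX f n ψ ∧ IsCycleN n ψ ∧ IsNChain eY f (n + 1) φ ∧
        pushf F n ψ = ζ + bdN n φ) := by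
  obtain ⟨G, hG, ⟨D, hGF⟩, D', hFG⟩ := hF.exists_quasi_inverse honto
  refine ⟨fun ψ hψ => ⟨hψ.pushf hf eY hF hbgX, fun hcyc => hcyc.pushf hψ hF hbgX⟩,
    fun φ hφ => pushf_bdN hφ hF hbgX, ?_, ?_⟩
  · rintro ψ hψ hcyc ⟨φ, hφ, hbd⟩
    obtain ⟨θ, hθ, he⟩ := exists_pushf_pushf_eq_add_bdN hf hbgX hGF hψ hcyc
    have hGφ : IsNChain eX f (n + 1) (pushf G (n + 1) φ) := hφ.pushf hf eX hG hbgY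
    refine ⟨pushf G (n + 1) φ - θ, (nChains hf eX (n + 1)).sub_mem hGφ hθ, ?_⟩
    rw [bdN_sub hGφ hθ hbgX, ← pushf_bdN hφ hG hbgY, ← hbd, he, add_sub_cancel_right]
  · intro ζ hζ hcyc
    obtain ⟨φ, hφ, he⟩ := exists_pushf_pushf_eq_add_bdN hf hbgY hFG hζ hcyc
    exact ⟨pushf G n ζ, φ, hζ.pushf hf eX hG hbgY, hcyc.pushf hζ hG hbgY, hφ, he⟩
end
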